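/- arXiv:2604.08490 — 2 statements merged into one kernel-verified Lean document; each statement's English description precedes it below -/
import Mathlib

section
/- Let Γ = (V, E) be a connected, locally finite, vertex-transitive simple graph of degree d with root o, assume Γ is unimodular, let G = Aut(Γ) with Haar measure λ normalized so that λ(G_o) = 1, and let μ = (1/d) Σ_{v ∼ o} λ|_{G_{o,v}}. Then for every n ≥ 1, the n-fold convolution μ^{*n} is absolutely continuous with respect to λ with density f = Σ_{v ∈ V} P(R_n = v)·1_{G_{o,v}}, and its Haar entropy equals the Shannon entropy of the simple random walk: ent_λ(μ^{*n}) = H(R_n). -/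
open scoped BigOperators ENNReal Pointwise
open MeasureTheory

/-- The topology of pointwise convergence on the automorphism group of a graph
(with the vertex set discrete): a net of automorphisms converges iff it converges
pointwise together with the inverses. -/
def autTop (V : Type) (Γ : SimpleGraph V) : TopologicalSpace (Γ ≃g Γ) :=
  letI : TopologicalSpace V := ⊥
  TopologicalSpace.induced
    (fun g => ((fun v => g v, fun v => g.symm v) : (V → V) × (V → V)))
    inferInstance

/-- The Borel σ-algebra of the topology of pointwise convergence on `Aut(Γ)`. -/
def autMeas (V : Type) (Γ : SimpleGraph V) : MeasurableSpace (Γ ≃g Γ) :=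
  @borel _ (autTop V Γ)

/-- A vertex-transitive graph is unimodular if `|G_v w| = |G_w v|` for all `v, w`, where
`G_v w` is the orbit of `w` under the stabilizer of `v` in the automorphism group. -/
def GraphUnimodular {V : Type*} (Γ : SimpleGraph V) : Prop :=
  ∀ v w : V,
    {x | ∃ φ : Γ ≃g Γ, φ v = v ∧ φ w = x}.ncard =
    {x | ∃ φ : Γ ≃g Γ, φ w = w ∧ φ v = x}.ncard

/-- The distribution of the simple random walk on `Γ` started at `o` after `n` steps. -/
noncomputable def walkP {V : Type*} (Γ : SimpleGraph V) (o : V) : ℕ → V → ℝ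
  | 0 => fun v => by classical exact if v = o then 1 else 0
  | n + 1 => fun v => by classical exact
      ∑' w, (if Γ.Adj w v then walkP Γ o n w / ((Γ.neighborSet w).ncard : ℝ) else 0)

/-- The Shannon entropy `H(R_n)` of the simple random walk after `n` steps. -/
noncomputable def walkEnt {V : Type*} (Γ : SimpleGraph V) (o : V) (n : ℕ) : ℝ :=
  -∑' v, walkP Γ o n v * Real.log (walkP Γ o n v)

/-- Convolution of two measures on a measurable group. -/
noncomputable def mconv {G : Type*} [Group G] [MeasurableSpace G]
    (μ ν : Measure G) : Measure G :=
  (μ.prod ν).map (fun p => p.1 * p.2)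

/-- `n`-fold convolution power of a measure on a measurable group. -/
noncomputable def mconvPow {G : Type*} [Group G] [MeasurableSpace G]
    (μ : Measure G) : ℕ → Measure G
  | 0 => Measure.dirac 1
  | n + 1 => mconv μ (mconvPow μ n)

section AutomorphismGroup

attribute [local instance] autTop autMeas

variable {V : Type} {Γ : SimpleGraph V}

lemma autMeas_borelSpace : BorelSpace (Γ ≃g Γ) := ⟨rfl⟩

lemma isOpen_aut_apply_eq (v w : V) : IsOpen {g : Γ ≃g Γ | g v = w} := by
  let : TopologicalSpace V := ⊥
  have : DiscreteTopology V := ⟨rfl⟩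
  have hc : Continuous fun g : Γ ≃g Γ =>
      ((fun v => g v, fun v => g.symm v) : (V → V) × (V → V)) := continuous_induced_dom
  have h : Continuous fun g : Γ ≃g Γ => g v :=
    (continuous_apply v).comp (continuous_fst.comp hc)
  exact (isOpen_discrete {w}).preimage h

lemma isOpen_aut_symm_apply_eq (v w : V) : IsOpen {g : Γ ≃g Γ | g.symm v = w} := by
  let : TopologicalSpace V := ⊥
  have : DiscreteTopology V := ⟨rfl⟩
  have hc : Continuous fun g : Γ ≃g Γ =>
      ((fun v => g v, fun v => g.symm v) : (V → V) × (V → V)) := continuous_induced_dom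
  have h : Continuous fun g : Γ ≃g Γ => g.symm v :=
    (continuous_apply v).comp (continuous_snd.comp hc)
  exact (isOpen_discrete {w}).preimage h

/-- A map into the automorphism group is continuous as soon as the values of its images and of
their inverses are locally constant. -/
lemma continuous_aut_of_isOpen {X : Type*} [TopologicalSpace X] {F : X → (Γ ≃g Γ)}
    (h₁ : ∀ v w, IsOpen {x | F x v = w}) (h₂ : ∀ v w, IsOpen {x | (F x).symm v = w}) :
    Continuous F := by
  let : TopologicalSpace V := ⊥
  have : DiscreteTopology V := ⟨rfl⟩
  refine continuous_induced_rng.2 (Continuous.prodMk ?_ ?_)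
  · exact continuous_pi fun v => continuous_discrete_rng.2 fun w => h₁ v w
  · exact continuous_pi fun v => continuous_discrete_rng.2 fun w => h₂ v w

lemma aut_isTopologicalGroup : IsTopologicalGroup (Γ ≃g Γ) where
  continuous_mul := by
    refine continuous_aut_of_isOpen (fun v w => ?_) (fun v w => ?_)
    · have : {p : (Γ ≃g Γ) × (Γ ≃g Γ) | (p.1 * p.2) v = w} =
          ⋃ u, {g : Γ ≃g Γ | g u = w} ×ˢ {g : Γ ≃g Γ | g v = u} := by
        ext p; simp
      rw [this]
      exact isOpen_iUnion fun u => (isOpen_aut_apply_eq u w).prod (isOpen_aut_apply_eq v u)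
    · have : {p : (Γ ≃g Γ) × (Γ ≃g Γ) | (p.1 * p.2).symm v = w} =
          ⋃ u, {g : Γ ≃g Γ | g.symm v = u} ×ˢ {g : Γ ≃g Γ | g.symm u = w} := by
        ext p
        simp only [Set.mem_ofPred_eq, Set.mem_iUnion, Set.mem_prod, exists_eq_left']
        rfl
      rw [this]
      exact isOpen_iUnion fun u =>
        (isOpen_aut_symm_apply_eq v u).prod (isOpen_aut_symm_apply_eq u w)
  continuous_inv :=
    continuous_aut_of_isOpen isOpen_aut_symm_apply_eq isOpen_aut_apply_eq

lemma aut_secondCountable [Countable V] : SecondCountableTopology (Γ ≃g Γ) := by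
  let : TopologicalSpace V := ⊥
  have : DiscreteTopology V := ⟨rfl⟩
  exact TopologicalSpace.secondCountableTopology_induced _ _ _

lemma aut_measurableMul₂ [Countable V] : MeasurableMul₂ (Γ ≃g Γ) := by
  have := autMeas_borelSpace (Γ := Γ)
  have := aut_isTopologicalGroup (Γ := Γ)
  have := aut_secondCountable (Γ := Γ)
  infer_instance

lemma aut_measurableInv : MeasurableInv (Γ ≃g Γ) := by
  have := autMeas_borelSpace (Γ := Γ)
  have := aut_isTopologicalGroup (Γ := Γ)
  infer_instance

lemma measurable_aut_apply [Countable V] (v : V) : Measurable[_, ⊤] fun g : Γ ≃g Γ => g v := by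
  have := autMeas_borelSpace (Γ := Γ)
  let : MeasurableSpace V := ⊤
  exact measurable_to_countable' fun w => (isOpen_aut_apply_eq v w).measurableSet

/-- Normalised left-invariant measure on a transitive automorphism group projects to counting
measure on the vertices. -/
lemma map_aut_apply_eq_count [Countable V] {o : V} {lam : Measure (Γ ≃g Γ)}
    (htrans : ∀ u v : V, ∃ φ : Γ ≃g Γ, φ u = v)
    (hinv : ∀ (g : Γ ≃g Γ) (A : Set (Γ ≃g Γ)), lam ((fun x => g * x) ⁻¹' A) = lam A)
    (hnorm : lam {g : Γ ≃g Γ | g o = o} = 1) :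
    @Measure.map _ _ _ ⊤ (fun g : Γ ≃g Γ => g o) lam = @Measure.count V ⊤ := by
  let : MeasurableSpace V := ⊤
  have : DiscreteMeasurableSpace V := ⟨fun _ => trivial⟩
  refine Measure.ext_of_singleton fun v => ?_
  rw [Measure.map_apply (measurable_aut_apply o) (measurableSet_singleton v),
    Measure.count_singleton]
  obtain ⟨φ, hφ⟩ := htrans o v
  rw [← hinv φ, ← hnorm]
  congr 1
  ext g
  simp [← hφ]

end AutomorphismGroup

section RandomWalk

variable {V : Type*} {Γ : SimpleGraph V}

lemma countable_of_connected_of_finite_neighborSet (hconn : Γ.Connected)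
    (hlf : ∀ v, (Γ.neighborSet v).Finite) : Countable V := by
  obtain ⟨o⟩ := hconn.nonempty
  let T : ℕ → Set V := fun n => (fun S => ⋃ u ∈ S, Γ.neighborSet u)^[n] {o}
  have hT : ∀ n, T (n + 1) = ⋃ u ∈ T n, Γ.neighborSet u := fun n =>
    Function.iterate_succ_apply' _ n _
  have hcount : ∀ n, (T n).Countable := by
    intro n
    induction n with
    | zero => exact Set.countable_singleton o
    | succ n ih => rw [hT]; exact ih.biUnion fun u _ => (hlf u).countable
  have hall : ∀ u v (p : Γ.Walk u v), u ∈ ⋃ n, T n → v ∈ ⋃ n, T n := by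
    intro u v p
    induction p with
    | nil => exact id
    | @cons a b c hab _ ih =>
      intro ha
      obtain ⟨n, hn⟩ := Set.mem_iUnion.1 ha
      exact ih (Set.mem_iUnion.2 ⟨n + 1, by rw [hT]; exact Set.mem_biUnion hn hab⟩)
  have huniv : (⋃ n, T n) = Set.univ := by
    refine Set.eq_univ_of_forall fun v => ?_
    obtain ⟨p⟩ := hconn.preconnected o v
    exact hall o v p (Set.mem_iUnion.2 ⟨0, rfl⟩)
  exact Set.countable_univ_iff.1 (huniv ▸ Set.countable_iUnion hcount)

lemma walkP_nonneg (o : V) (n : ℕ) (v : V) : 0 ≤ walkP Γ o n v := by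
  classical
  induction n generalizing v with
  | zero => simp only [walkP]; split_ifs <;> norm_num
  | succ n ih =>
    refine tsum_nonneg fun w => ?_
    split_ifs
    · exact div_nonneg (ih w) (Nat.cast_nonneg _)
    · exact le_rfl

/-- The law of the random walk is equivariant under graph automorphisms. -/
lemma walkP_aut (φ : Γ ≃g Γ) (o : V) (n : ℕ) (v : V) :
    walkP Γ (φ o) n (φ v) = walkP Γ o n v := by
  classical
  induction n generalizing v with
  | zero => simp [walkP]
  | succ n ih =>
    have hcard : ∀ w, (Γ.neighborSet (φ w)).ncard = (Γ.neighborSet w).ncard := fun w => by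
      rw [← Set.ncard_image_of_injective (Γ.neighborSet w) φ.injective]
      congr 1
      ext x
      simp only [SimpleGraph.mem_neighborSet, Set.mem_image]
      constructor
      · intro h
        exact ⟨φ.symm x, by rw [← φ.map_adj_iff]; simpa using h, by simp⟩
      · rintro ⟨y, hy, rfl⟩
        exact φ.map_adj_iff.2 hy
    simp only [walkP]
    rw [← φ.toEquiv.tsum_eq]
    refine tsum_congr fun w => ?_
    change (if Γ.Adj (φ w) (φ v) then
      walkP Γ (φ o) n (φ w) / ((Γ.neighborSet (φ w)).ncard : ℝ) else 0) = _
    simp only [ih, hcard, φ.map_adj_iff]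

lemma walkP_succ_eq_sum {d : ℕ} (hlf : ∀ v, (Γ.neighborSet v).Finite)
    (hreg : ∀ v, (Γ.neighborSet v).ncard = d) (o : V) (n : ℕ) (v : V) :
    walkP Γ o (n + 1) v = (d : ℝ)⁻¹ * ∑ w ∈ (hlf v).toFinset, walkP Γ o n w := by
  classical
  simp only [walkP]
  rw [tsum_eq_sum (s := (hlf v).toFinset), Finset.mul_sum]
  · refine Finset.sum_congr rfl fun w hw => ?_
    have hw' : Γ.Adj v w := by simpa using hw
    rw [if_pos hw'.symm, hreg, div_eq_inv_mul]
  · intro w hw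
    rw [if_neg]
    intro h
    exact hw (by simpa using h.symm)

/-- First-step decomposition of the random walk. -/
lemma walkP_succ_eq_sum_start {d : ℕ} (hlf : ∀ v, (Γ.neighborSet v).Finite)
    (hreg : ∀ v, (Γ.neighborSet v).ncard = d) (o : V) (n : ℕ) (v : V) :
    walkP Γ o (n + 1) v = (d : ℝ)⁻¹ * ∑ u ∈ (hlf o).toFinset, walkP Γ u n v := by
  classical
  induction n generalizing v with
  | zero =>
    rw [walkP_succ_eq_sum hlf hreg]
    simp [walkP, SimpleGraph.adj_comm]
  | succ n ih =>
    rw [walkP_succ_eq_sum hlf hreg]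
    simp_rw [ih, walkP_succ_eq_sum hlf hreg _ n v, ← Finset.mul_sum]
    rw [Finset.sum_comm]

end RandomWalk

section HaarEntropy

attribute [local instance] autTop autMeas

variable {V : Type} {Γ : SimpleGraph V} {o : V} {d : ℕ} {lam : Measure (Γ ≃g Γ)}

lemma setLIntegral_adj_aut_apply [Countable V]
    (hlf : ∀ v, (Γ.neighborSet v).Finite)
    (hmap : @Measure.map _ _ _ ⊤ (fun g : Γ ≃g Γ => g o) lam = @Measure.count V ⊤)
    (k : V → ℝ≥0∞) :
    ∫⁻ g in {g : Γ ≃g Γ | Γ.Adj (g o) o}, k (g o) ∂lam = ∑ v ∈ (hlf o).toFinset, k v := by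
  let : MeasurableSpace V := ⊤
  have : DiscreteMeasurableSpace V := ⟨fun _ => trivial⟩
  have h := setLIntegral_map (μ := lam) (s := {v | Γ.Adj v o}) (f := k)
    (MeasurableSet.of_discrete) (measurable_of_countable k) (measurable_aut_apply o)
  have hs : {v | Γ.Adj v o} = ((hlf o).toFinset : Set V) := by
    ext v; simp [SimpleGraph.adj_comm]
  rw [hmap, hs, lintegral_finset] at h
  simp only [Measure.count_singleton, mul_one] at h
  rw [h, ← hs]
  rfl

lemma mconv_withDensity_walkP [Countable V]
    (hlf : ∀ v, (Γ.neighborSet v).Finite) (hreg : ∀ v, (Γ.neighborSet v).ncard = d)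
    (hinv : ∀ (g : Γ ≃g Γ) (A : Set (Γ ≃g Γ)), lam ((fun x => g * x) ⁻¹' A) = lam A)
    (hmap : @Measure.map _ _ _ ⊤ (fun g : Γ ≃g Γ => g o) lam = @Measure.count V ⊤) [SFinite lam]
    (hd : d ≠ 0) (n : ℕ) :
    mconv ((d : ℝ≥0∞)⁻¹ • lam.restrict {g : Γ ≃g Γ | Γ.Adj (g o) o})
        (lam.withDensity fun g => ENNReal.ofReal (walkP Γ o n (g o))) =
      lam.withDensity fun g => ENNReal.ofReal (walkP Γ o (n + 1) (g o)) := by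
  have := aut_measurableMul₂ (Γ := Γ)
  have := aut_measurableInv (Γ := Γ)
  have hd' : (d : ℝ≥0∞)⁻¹ ≠ ⊤ := by simpa using hd
  have : lam.IsMulLeftInvariant := ⟨fun g => by
    ext A hA
    rw [Measure.map_apply (measurable_const_mul g) hA, hinv]⟩
  have hf : Measurable fun g : Γ ≃g Γ => ENNReal.ofReal (walkP Γ o n (g o)) :=
    (@measurable_from_top _ _ _ fun v => ENNReal.ofReal (walkP Γ o n v)).comp
      (measurable_aut_apply o)
  set f : (Γ ≃g Γ) → ℝ≥0∞ := fun g => ENNReal.ofReal (walkP Γ o n (g o)) with hfdef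
  set S : Set (Γ ≃g Γ) := {g : Γ ≃g Γ | Γ.Adj (g o) o}
  ext A hA
  have hind : Measurable (A.indicator (1 : (Γ ≃g Γ) → ℝ≥0∞)) := measurable_one.indicator hA
  have hstep : ∀ y : Γ ≃g Γ, (d : ℝ≥0∞)⁻¹ * ∫⁻ x in S, f (x⁻¹ * y) ∂lam =
      ENNReal.ofReal (walkP Γ o (n + 1) (y o)) := by
    intro y
    have h1 : ∀ x : Γ ≃g Γ, f (x⁻¹ * y) = ENNReal.ofReal (walkP Γ (x o) n (y o)) := by
      intro x
      simp only [hfdef]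
      rw [← walkP_aut x o n]
      congr 2
      exact x.apply_symm_apply (y o)
    simp_rw [h1]
    rw [setLIntegral_adj_aut_apply hlf hmap fun v => ENNReal.ofReal (walkP Γ v n (y o)),
      walkP_succ_eq_sum_start hlf hreg, ENNReal.ofReal_mul (by positivity),
      ENNReal.ofReal_sum_of_nonneg fun _ _ => walkP_nonneg _ _ _,
      ENNReal.ofReal_inv_of_pos (by positivity), ENNReal.ofReal_natCast]
  have hmul : Measurable fun p : (Γ ≃g Γ) × (Γ ≃g Γ) => p.1 * p.2 := measurable_mul
  calc mconv ((d : ℝ≥0∞)⁻¹ • lam.restrict S) (lam.withDensity f) A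
      = (d : ℝ≥0∞)⁻¹ * ∫⁻ x in S, lam.withDensity f ((fun y => x * y) ⁻¹' A) ∂lam := by
        rw [mconv, Measure.map_apply hmul hA, Measure.prod_apply (hmul hA),
          lintegral_smul_measure]
        rfl
    _ = (d : ℝ≥0∞)⁻¹ * ∫⁻ x in S, ∫⁻ y, f (x⁻¹ * y) * A.indicator 1 y ∂lam ∂lam := by
        congr 1
        refine lintegral_congr fun x => ?_
        have hxA : MeasurableSet ((fun y => x * y) ⁻¹' A) := measurable_const_mul x hA
        rw [withDensity_apply _ hxA, ← lintegral_indicator hxA,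
          ← lintegral_mul_left_eq_self (fun y => f (x⁻¹ * y) * A.indicator 1 y) x]
        refine lintegral_congr fun y => ?_
        by_cases hy : x * y ∈ A <;> simp [hy]
    _ = (d : ℝ≥0∞)⁻¹ * ∫⁻ y, (∫⁻ x in S, f (x⁻¹ * y) ∂lam) * A.indicator 1 y ∂lam := by
        rw [lintegral_lintegral_swap]
        · congr 1
          refine lintegral_congr fun y => ?_
          exact lintegral_mul_const _ (hf.comp (measurable_inv.mul_const y))
        · exact ((hf.comp (measurable_fst.inv.mul measurable_snd)).mul
            (hind.comp measurable_snd)).aemeasurable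
    _ = ∫⁻ y, ENNReal.ofReal (walkP Γ o (n + 1) (y o)) * A.indicator 1 y ∂lam := by
        rw [← lintegral_const_mul' _ _ hd']
        refine lintegral_congr fun y => ?_
        rw [← mul_assoc, hstep]
    _ = lam.withDensity (fun g => ENNReal.ofReal (walkP Γ o (n + 1) (g o))) A := by
        rw [withDensity_apply _ hA, ← lintegral_indicator hA]
        refine lintegral_congr fun y => ?_
        by_cases hy : y ∈ A <;> simp [hy]

lemma smul_restrict_adj_eq_withDensity [Countable V]
    (hlf : ∀ v, (Γ.neighborSet v).Finite) (hreg : ∀ v, (Γ.neighborSet v).ncard = d)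
    (hd : d ≠ 0) :
    (d : ℝ≥0∞)⁻¹ • lam.restrict {g : Γ ≃g Γ | Γ.Adj (g o) o} =
      lam.withDensity fun g => ENNReal.ofReal (walkP Γ o 1 (g o)) := by
  classical
  have hS : MeasurableSet {g : Γ ≃g Γ | Γ.Adj (g o) o} :=
    measurable_aut_apply (Γ := Γ) o (t := {v | Γ.Adj v o}) trivial
  rw [← withDensity_const, ← withDensity_indicator hS]
  congr 1
  ext g
  rw [walkP_succ_eq_sum hlf hreg]
  by_cases h : Γ.Adj (g o) o
  · rw [Set.indicator_of_mem (by exact h)]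
    simp [walkP, h, ENNReal.ofReal_inv_of_pos (Nat.cast_pos.2 (Nat.pos_of_ne_zero hd))]
  · rw [Set.indicator_of_notMem (by exact h)]
    simp [walkP, h]

lemma mconvPow_eq_withDensity_walkP [Countable V]
    (hlf : ∀ v, (Γ.neighborSet v).Finite) (hreg : ∀ v, (Γ.neighborSet v).ncard = d)
    (hinv : ∀ (g : Γ ≃g Γ) (A : Set (Γ ≃g Γ)), lam ((fun x => g * x) ⁻¹' A) = lam A)
    (hmap : @Measure.map _ _ _ ⊤ (fun g : Γ ≃g Γ => g o) lam = @Measure.count V ⊤) [SFinite lam]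
    (n : ℕ) :
    mconvPow ((d : ℝ≥0∞)⁻¹ • lam.restrict {g : Γ ≃g Γ | Γ.Adj (g o) o}) (n + 1) =
      lam.withDensity fun g => ENNReal.ofReal (walkP Γ o (n + 1) (g o)) := by
  rcases eq_or_ne d 0 with rfl | hd
  · have hadj : ∀ u v, ¬ Γ.Adj u v := fun u v h =>
      ((Set.ncard_eq_zero (hlf u)).1 (hreg u)).le h
    have hP : ∀ v, walkP Γ o (n + 1) v = 0 := fun v => by simp [walkP, hadj]
    simp [mconvPow, mconv, hadj, hP]
  induction n with
  | zero =>
    have := aut_measurableMul₂ (Γ := Γ)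
    rw [← smul_restrict_adj_eq_withDensity hlf hreg hd, mconvPow, mconvPow]
    rw [mconv, Measure.prod_dirac, Measure.map_map measurable_mul (by fun_prop)]
    have : ((fun p : (Γ ≃g Γ) × (Γ ≃g Γ) => p.1 * p.2) ∘ fun x => (x, 1)) = id := by
      ext1 x; simp
    rw [this, Measure.map_id]
  | succ n ih =>
    rw [mconvPow, ih, mconv_withDensity_walkP hlf hreg hinv hmap hd]

lemma integral_aut_apply_eq_tsum [Countable V]
    (hmap : @Measure.map _ _ _ ⊤ (fun g : Γ ≃g Γ => g o) lam = @Measure.count V ⊤)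
    (F : V → ℝ) : ∫ g, F (g o) ∂lam = ∑' v, F v := by
  let : MeasurableSpace V := ⊤
  have : DiscreteMeasurableSpace V := ⟨fun _ => trivial⟩
  have h := integral_map (μ := lam) (f := F) (measurable_aut_apply o).aemeasurable
    (measurable_of_countable F).aestronglyMeasurable
  rw [← h, hmap]
  by_cases hF : Summable F
  · rw [integral_countable (integrable_count_iff.2 hF.norm)]
    simp [measureReal_def]
  · rw [tsum_eq_zero_of_not_summable hF, integral_undef]
    exact fun hi => hF (Summable.of_norm (integrable_count_iff.1 hi))

end HaarEntropy

theorem stmt13 (V : Type) (Γ : SimpleGraph V) (o : V) (d : ℕ)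
    (hconn : Γ.Connected) (hlf : ∀ v, (Γ.neighborSet v).Finite)
    (htrans : ∀ u v : V, ∃ φ : Γ ≃g Γ, φ u = v)
    (hreg : ∀ v, (Γ.neighborSet v).ncard = d)
    (huni : GraphUnimodular Γ)
    (lam : @Measure (Γ ≃g Γ) (autMeas V Γ))
    (hinv : ∀ (g : Γ ≃g Γ) (A : Set (Γ ≃g Γ)), lam ((fun x => g * x) ⁻¹' A) = lam A)
    (hnorm : lam {g : Γ ≃g Γ | g o = o} = 1) :
    letI := autMeas V Γ
    ∀ μ : Measure (Γ ≃g Γ),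
      μ = (d : ℝ≥0∞)⁻¹ • lam.restrict {g : Γ ≃g Γ | Γ.Adj (g o) o} →
      ∀ n : ℕ, 1 ≤ n →
        mconvPow μ n =
          lam.withDensity (fun g => ENNReal.ofReal (walkP Γ o n (g o))) ∧
        (-∫ g, walkP Γ o n (g o) * Real.log (walkP Γ o n (g o)) ∂lam) =
          walkEnt Γ o n := by
  intro μ hμ n hn
  have := countable_of_connected_of_finite_neighborSet hconn hlf
  have hmap := map_aut_apply_eq_count htrans hinv hnorm
  have : SigmaFinite lam := by
    let : MeasurableSpace V := ⊤
    have : DiscreteMeasurableSpace V := ⟨fun _ => trivial⟩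
    refine SigmaFinite.of_map lam (measurable_aut_apply o).aemeasurable ?_
    rw [hmap]
    infer_instance
  obtain ⟨m, rfl⟩ := Nat.exists_eq_add_of_le' hn
  subst hμ
  refine ⟨mconvPow_eq_withDensity_walkP hlf hreg hinv hmap m, ?_⟩
  rw [walkEnt, integral_aut_apply_eq_tsum hmap fun v =>
    walkP Γ o (m + 1) v * Real.log (walkP Γ o (m + 1) v)]
end

section
/- Let t ≥ 1 and let a₁, …, a_t, b₁, …, b_t be positive integers with Σ_{i=1}^t a_i = Σ_{i=1}^t b_i = d and (a₁, …, a_t) ≠ (b₁, …, b_t). Then Σ_{i=1}^t √(a_i · b_i) ≤ √(d² − 1). -/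
open scoped BigOperators

/-- The two-block case, from `(pq + rs)² + (ps - qr)² = (p² + r²)(q² + s²)`. -/
theorem mul_add_mul_le_sqrt_sq_sub_one {p q r s d : ℝ} (hp : 0 ≤ p) (hq : 0 ≤ q)
    (hr : 0 ≤ r) (hs : 0 ≤ s) (hd : 0 < d) (hpr : p ^ 2 + r ^ 2 = d)
    (hqs : q ^ 2 + s ^ 2 = d) (hpq : q ^ 2 + 1 ≤ p ^ 2) :
    p * q + r * s ≤ √(d ^ 2 - 1) := by
  have hle : p * s + q * r ≤ d := by nlinarith [sq_nonneg (p - s), sq_nonneg (q - r)]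
  have hfac : (p * s - q * r) * (p * s + q * r) = d * (p ^ 2 - q ^ 2) := by
    have hs2 : s ^ 2 = d - q ^ 2 := by linarith
    have hr2 : r ^ 2 = d - p ^ 2 := by linarith
    linear_combination p ^ 2 * hs2 - q ^ 2 * hr2
  have hge : 1 ≤ p * s - q * r := by
    have hprod : d ≤ (p * s - q * r) * (p * s + q * r) := by
      rw [hfac]
      exact le_mul_of_one_le_right hd.le (by linarith)
    have hnonneg : 0 ≤ p * s + q * r := by positivity
    have hpos : 0 < p * s + q * r := hnonneg.lt_of_ne fun h => by
      rw [← h, mul_zero] at hprod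
      linarith
    exact le_of_mul_le_mul_right (by linarith) hpos
  have hid : (p * q + r * s) ^ 2 + (p * s - q * r) ^ 2 = d ^ 2 := by
    linear_combination (q ^ 2 + s ^ 2) * hpr + d * hqs
  exact Real.le_sqrt_of_sq_le (by nlinarith)

theorem stmt15 (t d : ℕ) (ht : 1 ≤ t) (a b : Fin t → ℕ)
    (ha : ∀ i, 0 < a i) (hb : ∀ i, 0 < b i)
    (hsa : ∑ i, a i = d) (hsb : ∑ i, b i = d)
    (hne : a ≠ b) :
    ∑ i, Real.sqrt ((a i : ℝ) * (b i : ℝ)) ≤ Real.sqrt ((d : ℝ) ^ 2 - 1) := by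
  have hex : ∃ i, b i < a i := by
    by_contra! h
    have heq := (Finset.sum_eq_sum_iff_of_le fun i _ => h i).1 (hsa.trans hsb.symm)
    exact hne (funext fun i => heq i (Finset.mem_univ i))
  obtain ⟨j, hj⟩ := hex
  have hd : 0 < d := hsa ▸ (ha j).trans_le
    (Finset.single_le_sum (fun i _ => Nat.zero_le (a i)) (Finset.mem_univ j))
  set S : Finset (Fin t) := {i | b i < a i} with hS
  have hlt : ∑ i ∈ S, b i < ∑ i ∈ S, a i :=
    Finset.sum_lt_sum_of_nonempty ⟨j, by simpa [hS] using hj⟩ fun i hi => by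
      simpa [hS] using hi
  have hcs (T : Finset (Fin t)) : ∑ i ∈ T, √((a i : ℝ) * b i) ≤
      √(∑ i ∈ T, (a i : ℝ)) * √(∑ i ∈ T, (b i : ℝ)) := by
    simp_rw [Real.sqrt_mul (Nat.cast_nonneg _)]
    exact Real.sum_sqrt_mul_sqrt_le _ (fun i => Nat.cast_nonneg _) (fun i => Nat.cast_nonneg _)
  have hsq (f : Fin t → ℕ) (T : Finset (Fin t)) :
      √(∑ i ∈ T, (f i : ℝ)) ^ 2 = ∑ i ∈ T, (f i : ℝ) := Real.sq_sqrt (by positivity)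
  rw [← Finset.sum_add_sum_compl S]
  refine (add_le_add (hcs S) (hcs Sᶜ)).trans
    (mul_add_mul_le_sqrt_sq_sub_one (Real.sqrt_nonneg _) (Real.sqrt_nonneg _)
      (Real.sqrt_nonneg _) (Real.sqrt_nonneg _) (Nat.cast_pos.2 hd) ?_ ?_ ?_)
  · rw [hsq, hsq, Finset.sum_add_sum_compl]
    exact_mod_cast hsa
  · rw [hsq, hsq, Finset.sum_add_sum_compl]
    exact_mod_cast hsb
  · rw [hsq, hsq]
    exact_mod_cast hlt
end
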